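/- In the overlap array setup, suppose μ satisfies the Ghirlanda–Guerra identities for both system 1 and system 2. Then for every n ≥ 1 and all Borel sets A ⊆ [−1,1], A₁ ⊆ [0,1], A₂ ⊆ [0,1], one has μ(B_n) ≥ (μ₁(A₁) μ₂(A₂))^{n−1} · μ_{1,2}(A). -/

import Mathlib

open MeasureTheory

namespace OverlapArray

/-- The space `([-1,1]^{ℕ×ℕ})³` of triples of overlap arrays
`((R¹_{l,l'}), (R²_{l,l'}), (R_{l,l'}))` (realized inside `(ℝ^{ℕ×ℕ})³`, the constraint that
entries lie in `[-1,1]` being imposed almost surely). -/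
abbrev OA : Type := (ℕ → ℕ → ℝ) × (ℕ → ℕ → ℝ) × (ℕ → ℕ → ℝ)

/-- The overlap array `(R¹_{l,l'})` of the first system. -/
def R1 (ω : OA) : ℕ → ℕ → ℝ := ω.1

/-- The overlap array `(R²_{l,l'})` of the second system. -/
def R2 (ω : OA) : ℕ → ℕ → ℝ := ω.2.1

/-- The array `(R_{l,l'})` of cross overlaps. -/
def R (ω : OA) : ℕ → ℕ → ℝ := ω.2.2

/-- Relabelling the replicas of the first system by `π` and of the second system by `π'`. -/
def permMap (π π' : Equiv.Perm ℕ) (ω : OA) : OA :=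
  (fun l l' => R1 ω (π l) (π l'), fun l l' => R2 ω (π' l) (π' l'),
   fun l l' => R ω (π l) (π' l'))

/-- The overlap array setup: `μ` is a probability measure on `OA` with entries a.s. in
`[-1,1]`, `R¹, R²` a.s. symmetric with unit diagonal, and `μ` invariant under finitely
supported permutations of the replicas of each system. -/
structure Setup (μ : Measure OA) : Prop where
  prob : IsProbabilityMeasure μ
  bounded : ∀ᵐ ω ∂μ, ∀ l l', |R1 ω l l'| ≤ 1 ∧ |R2 ω l l'| ≤ 1 ∧ |R ω l l'| ≤ 1
  symm : ∀ᵐ ω ∂μ, ∀ l l', R1 ω l l' = R1 ω l' l ∧ R2 ω l l' = R2 ω l' l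
  diag : ∀ᵐ ω ∂μ, ∀ l, R1 ω l l = 1 ∧ R2 ω l l = 1
  exch : ∀ π π' : Equiv.Perm ℕ, {x | π x ≠ x}.Finite → {x | π' x ≠ x}.Finite →
    μ.map (permMap π π') = μ

/-- Evaluation of a function `f` of the overlaps on the first `n` replicas. -/
def fRep (n : ℕ)
    (f : ((Fin n → Fin n → ℝ) × (Fin n → Fin n → ℝ) × (Fin n → Fin n → ℝ)) → ℝ)
    (ω : OA) : ℝ :=
  f (fun l l' => R1 ω l.val l'.val, fun l l' => R2 ω l.val l'.val,
     fun l l' => R ω l.val l'.val)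

/-- The Ghirlanda–Guerra identities for system 1: for every `n ≥ 1`, every bounded
measurable function `f` of the overlaps on `n` replicas and every bounded Borel even
`ψ : [-1,1] → ℝ`,
`E[f·ψ(R¹_{1,n+1})] = (1/n) E[f]·E[ψ(R¹_{1,2})] + (1/n) ∑_{l=2}^n E[f·ψ(R¹_{1,l})]`
(replicas are indexed from `0` here, so `R¹_{1,l}` is `R1 ω 0 (l-1)`). -/
def GG1 (μ : Measure OA) : Prop :=
  ∀ n : ℕ, 1 ≤ n →
  ∀ f : ((Fin n → Fin n → ℝ) × (Fin n → Fin n → ℝ) × (Fin n → Fin n → ℝ)) → ℝ,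
    Measurable f → (∃ C, ∀ v, |f v| ≤ C) →
  ∀ ψ : ℝ → ℝ, Measurable ψ → (∃ C, ∀ x, |ψ x| ≤ C) → (∀ x, ψ (-x) = ψ x) →
    ∫ ω, fRep n f ω * ψ (R1 ω 0 n) ∂μ
      = (1 / n) * (∫ ω, fRep n f ω ∂μ) * (∫ ω, ψ (R1 ω 0 1) ∂μ)
        + (1 / n) * ∑ l ∈ Finset.Ico 1 n, ∫ ω, fRep n f ω * ψ (R1 ω 0 l) ∂μ

/-- The Ghirlanda–Guerra identities for system 2. -/
def GG2 (μ : Measure OA) : Prop :=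
  ∀ n : ℕ, 1 ≤ n →
  ∀ f : ((Fin n → Fin n → ℝ) × (Fin n → Fin n → ℝ) × (Fin n → Fin n → ℝ)) → ℝ,
    Measurable f → (∃ C, ∀ v, |f v| ≤ C) →
  ∀ ψ : ℝ → ℝ, Measurable ψ → (∃ C, ∀ x, |ψ x| ≤ C) → (∀ x, ψ (-x) = ψ x) →
    ∫ ω, fRep n f ω * ψ (R2 ω 0 n) ∂μ
      = (1 / n) * (∫ ω, fRep n f ω ∂μ) * (∫ ω, ψ (R2 ω 0 1) ∂μ)
        + (1 / n) * ∑ l ∈ Finset.Ico 1 n, ∫ ω, fRep n f ω * ψ (R2 ω 0 l) ∂μ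

/-- The event `{R_{1,1} ∈ A}`. -/
def EA (A : Set ℝ) : Set OA := {ω | R ω 0 0 ∈ A}

/-- The event `{|R¹_{l,l'}| ∈ A₁ for all l ≠ l' ≤ n}` (with `0`-based replica indices). -/
def E1 (n : ℕ) (A1 : Set ℝ) : Set OA :=
  {ω | ∀ l l', l < n → l' < n → l ≠ l' → |R1 ω l l'| ∈ A1}

/-- The event `{|R²_{l,l'}| ∈ A₂ for all l ≠ l' ≤ n}` (with `0`-based replica indices). -/
def E2 (n : ℕ) (A2 : Set ℝ) : Set OA :=
  {ω | ∀ l l', l < n → l' < n → l ≠ l' → |R2 ω l l'| ∈ A2}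

/-- The event `B_n`. -/
def Bev (n : ℕ) (A A1 A2 : Set ℝ) : Set OA := EA A ∩ E1 n A1 ∩ E2 n A2

/-- The event `C_n`. -/
def Cev (n : ℕ) (A A1 A2 : Set ℝ) : Set OA := EA A ∩ E1 (n + 1) A1 ∩ E2 n A2

end OverlapArray

open OverlapArray

namespace OverlapArray

/-- Restriction of the arrays to the first `n` replicas. -/
def projRep (n : ℕ) (ω : OA) :
    (Fin n → Fin n → ℝ) × (Fin n → Fin n → ℝ) × (Fin n → Fin n → ℝ) :=
  (fun l l' => R1 ω l.val l'.val, fun l l' => R2 ω l.val l'.val,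
     fun l l' => R ω l.val l'.val)

lemma measurable_R1 (i j : ℕ) : Measurable fun ω : OA => R1 ω i j := by
  unfold R1; fun_prop

lemma measurable_R2 (i j : ℕ) : Measurable fun ω : OA => R2 ω i j := by
  unfold R2; fun_prop

lemma measurable_R (i j : ℕ) : Measurable fun ω : OA => R ω i j := by
  unfold R; fun_prop

lemma measurable_projRep (n : ℕ) : Measurable (projRep n) := by
  unfold projRep R1 R2 R; fun_prop

lemma measurable_permMap (π π' : Equiv.Perm ℕ) : Measurable (permMap π π') := by
  unfold permMap R1 R2 R; fun_prop

lemma measurableSet_abs1 {T : Set ℝ} (hT : MeasurableSet T) (i j : ℕ) :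
    MeasurableSet {ω : OA | |R1 ω i j| ∈ T} :=
  (measurable_R1 i j).abs hT

lemma measurableSet_abs2 {T : Set ℝ} (hT : MeasurableSet T) (i j : ℕ) :
    MeasurableSet {ω : OA | |R2 ω i j| ∈ T} :=
  (measurable_R2 i j).abs hT

lemma measurableSet_E1 {T : Set ℝ} (hT : MeasurableSet T) (n : ℕ) :
    MeasurableSet (E1 n T) := by
  unfold E1
  simp only [Set.setOf_forall]
  exact .iInter fun i => .iInter fun j => .iInter fun _ => .iInter fun _ => .iInter fun _ =>
    measurableSet_abs1 hT i j

lemma measurableSet_E2 {T : Set ℝ} (hT : MeasurableSet T) (n : ℕ) :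
    MeasurableSet (E2 n T) := by
  unfold E2
  simp only [Set.setOf_forall]
  exact .iInter fun i => .iInter fun j => .iInter fun _ => .iInter fun _ => .iInter fun _ =>
    measurableSet_abs2 hT i j

/-- The event with parameters used in the proof. -/
def Hev (i j m n : ℕ) (A A1 A2 : Set ℝ) : Set OA := {ω | R ω i j ∈ A} ∩ E1 m A1 ∩ E2 n A2

lemma measurableSet_Hev {A A1 A2 : Set ℝ} (hA : MeasurableSet A) (hA1 : MeasurableSet A1)
    (hA2 : MeasurableSet A2) (i j m n : ℕ) : MeasurableSet (Hev i j m n A A1 A2) :=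
  ((measurable_R i j hA).inter (measurableSet_E1 hA1 m)).inter (measurableSet_E2 hA2 n)

lemma Hev_eq_preimage {A A1 A2 : Set ℝ} (hA : MeasurableSet A) (hA1 : MeasurableSet A1)
    (hA2 : MeasurableSet A2) (i j m n N : ℕ) (hi : i < N) (hj : j < N) (hm : m ≤ N)
    (hn : n ≤ N) : ∃ S, MeasurableSet S ∧ Hev i j m n A A1 A2 = projRep N ⁻¹' S := by
  classical
  -- extend a finite array by zero
  let ext : (Fin N → Fin N → ℝ) × (Fin N → Fin N → ℝ) × (Fin N → Fin N → ℝ) → OA := fun v =>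
    (fun a b => if h : a < N ∧ b < N then v.1 ⟨a, h.1⟩ ⟨b, h.2⟩ else 0,
     fun a b => if h : a < N ∧ b < N then v.2.1 ⟨a, h.1⟩ ⟨b, h.2⟩ else 0,
     fun a b => if h : a < N ∧ b < N then v.2.2 ⟨a, h.1⟩ ⟨b, h.2⟩ else 0)
  have hext : Measurable ext := by
    refine Measurable.prodMk ?_ (Measurable.prodMk ?_ ?_) <;>
    · refine measurable_pi_lambda _ fun a => measurable_pi_lambda _ fun b => ?_
      by_cases h : a < N ∧ b < N
      · simp only [h, and_self, dite_true]; fun_prop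
      · simp only [h, dite_false]; fun_prop
  refine ⟨ext ⁻¹' Hev i j m n A A1 A2, hext (measurableSet_Hev hA hA1 hA2 i j m n), ?_⟩
  have e1 : ∀ ω a b, a < N → b < N → R1 (ext (projRep N ω)) a b = R1 ω a b := by
    intro ω a b ha hb
    show (if h : a < N ∧ b < N then R1 ω a b else 0) = _
    simp [ha, hb]
  have e2 : ∀ ω a b, a < N → b < N → R2 (ext (projRep N ω)) a b = R2 ω a b := by
    intro ω a b ha hb
    show (if h : a < N ∧ b < N then R2 ω a b else 0) = _
    simp [ha, hb]
  have e3 : ∀ ω a b, a < N → b < N → R (ext (projRep N ω)) a b = R ω a b := by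
    intro ω a b ha hb
    show (if h : a < N ∧ b < N then R ω a b else 0) = _
    simp [ha, hb]
  ext ω
  simp only [Hev, E1, E2, Set.mem_inter_iff, Set.mem_setOf_eq, Set.mem_preimage, e3 ω i j hi hj]
  refine and_congr (and_congr Iff.rfl ?_) ?_
  · refine forall_congr' fun a => forall_congr' fun b => forall_congr' fun ha =>
      forall_congr' fun hb => ?_
    rw [e1 ω a b (by omega) (by omega)]
  · refine forall_congr' fun a => forall_congr' fun b => forall_congr' fun ha =>
      forall_congr' fun hb => ?_
    rw [e2 ω a b (by omega) (by omega)]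

lemma swap_finite (a b : ℕ) : {x | Equiv.swap a b x ≠ x}.Finite := by
  refine (Set.toFinite {a, b}).subset fun x hx => ?_
  by_contra h
  simp only [Set.mem_insert_iff, Set.mem_singleton_iff, not_or] at h
  exact hx (Equiv.swap_apply_of_ne_of_ne h.1 h.2)

lemma real_preimage_permMap {μ : Measure OA} (hs : Setup μ) (π π' : Equiv.Perm ℕ)
    (h : {x | π x ≠ x}.Finite) (h' : {x | π' x ≠ x}.Finite) {D : Set OA}
    (hD : MeasurableSet D) : μ.real (permMap π π' ⁻¹' D) = μ.real D := by
  conv_rhs => rw [← hs.exch π π' h h']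
  rw [measureReal_def, measureReal_def, Measure.map_apply (measurable_permMap π π') hD]

lemma mem_E1_perm {T : Set ℝ} (n : ℕ) (π π' : Equiv.Perm ℕ) (hπ : ∀ x, π x < n ↔ x < n)
    (ω : OA) : permMap π π' ω ∈ E1 n T ↔ ω ∈ E1 n T := by
  show (∀ l l', l < n → l' < n → l ≠ l' → |R1 ω (π l) (π l')| ∈ T) ↔
    (∀ l l', l < n → l' < n → l ≠ l' → |R1 ω l l'| ∈ T)
  constructor
  · intro h l l' hl hl' hne
    have := h (π.symm l) (π.symm l') ((hπ _).1 (by simpa)) ((hπ _).1 (by simpa)) (by simpa)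
    simpa using this
  · intro h l l' hl hl' hne
    exact h _ _ ((hπ _).2 hl) ((hπ _).2 hl') (by simpa)

lemma mem_E2_perm {T : Set ℝ} (n : ℕ) (π π' : Equiv.Perm ℕ) (hπ : ∀ x, π' x < n ↔ x < n)
    (ω : OA) : permMap π π' ω ∈ E2 n T ↔ ω ∈ E2 n T := by
  show (∀ l l', l < n → l' < n → l ≠ l' → |R2 ω (π' l) (π' l')| ∈ T) ↔
    (∀ l l', l < n → l' < n → l ≠ l' → |R2 ω l l'| ∈ T)
  constructor
  · intro h l l' hl hl' hne
    have := h (π'.symm l) (π'.symm l') ((hπ _).1 (by simpa)) ((hπ _).1 (by simpa)) (by simpa)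
    simpa using this
  · intro h l l' hl hl' hne
    exact h _ _ ((hπ _).2 hl) ((hπ _).2 hl') (by simpa)

lemma swap_lt_iff {a b n : ℕ} (h : a < n ↔ b < n) (x : ℕ) : Equiv.swap a b x < n ↔ x < n := by
  rw [Equiv.swap_apply_def]
  split_ifs <;> simp_all

lemma mem_Hev_perm {A A1 A2 : Set ℝ} (i j m n : ℕ) (π π' : Equiv.Perm ℕ)
    (hπ : ∀ x, π x < m ↔ x < m) (hπ' : ∀ x, π' x < n ↔ x < n) (ω : OA) :
    permMap π π' ω ∈ Hev i j m n A A1 A2 ↔ ω ∈ Hev (π i) (π' j) m n A A1 A2 := by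
  unfold Hev
  rw [Set.mem_inter_iff, Set.mem_inter_iff, mem_E1_perm m π π' hπ, mem_E2_perm n π π' hπ']
  rfl

lemma GG1_set {μ : Measure OA} (hs : Setup μ) (hGG : GG1 μ) (N : ℕ) (hN : 1 ≤ N) {T : Set ℝ}
    (hT : MeasurableSet T) {D : Set OA} (hD : ∃ S, MeasurableSet S ∧ D = projRep N ⁻¹' S) :
    μ.real (D ∩ {ω | |R1 ω 0 N| ∈ T}) = (1 / N) * μ.real D * μ.real {ω | |R1 ω 0 1| ∈ T}
      + (1 / N) * ∑ l ∈ Finset.Ico 1 N, μ.real (D ∩ {ω | |R1 ω 0 l| ∈ T}) := by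
  classical
  have := hs.prob
  obtain ⟨S, hS, rfl⟩ := hD
  have hDm : MeasurableSet (projRep N ⁻¹' S) := measurable_projRep N hS
  have key := hGG N hN (S.indicator fun _ => 1) (measurable_const.indicator hS)
    ⟨1, fun v => by by_cases h : v ∈ S <;> simp [h]⟩
    (fun x => T.indicator (fun _ => 1) |x|)
    ((measurable_const.indicator hT).comp measurable_id.abs)
    ⟨1, fun x => by by_cases h : |x| ∈ T <;> simp [h]⟩ (fun x => by simp only [abs_neg])
  have a1 : ∀ l, ∫ ω, fRep N (S.indicator fun _ => 1) ω
      * (fun x : ℝ => T.indicator (fun _ => (1 : ℝ)) |x|) (R1 ω 0 l) ∂μ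
      = μ.real (projRep N ⁻¹' S ∩ {ω | |R1 ω 0 l| ∈ T}) := by
    intro l
    rw [← integral_indicator_one (hDm.inter (measurableSet_abs1 hT 0 l))]
    congr 1
    funext ω
    show S.indicator (fun _ => (1 : ℝ)) (projRep N ω) * T.indicator (fun _ => (1 : ℝ)) |R1 ω 0 l| = _
    by_cases h : projRep N ω ∈ S <;> by_cases h' : |R1 ω 0 l| ∈ T <;> simp [h, h']
  have a2 : ∫ ω, fRep N (S.indicator fun _ => 1) ω ∂μ = μ.real (projRep N ⁻¹' S) := by
    rw [← integral_indicator_one hDm]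
    rfl
  have a3 : ∫ ω, (fun x : ℝ => T.indicator (fun _ => (1 : ℝ)) |x|) (R1 ω 0 1) ∂μ
      = μ.real {ω | |R1 ω 0 1| ∈ T} := by
    rw [← integral_indicator_one (measurableSet_abs1 hT 0 1)]
    rfl
  rw [a1, a2, a3] at key
  rw [key]
  congr 2
  exact Finset.sum_congr rfl fun l _ => a1 l

lemma GG2_set {μ : Measure OA} (hs : Setup μ) (hGG : GG2 μ) (N : ℕ) (hN : 1 ≤ N) {T : Set ℝ}
    (hT : MeasurableSet T) {D : Set OA} (hD : ∃ S, MeasurableSet S ∧ D = projRep N ⁻¹' S) :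
    μ.real (D ∩ {ω | |R2 ω 0 N| ∈ T}) = (1 / N) * μ.real D * μ.real {ω | |R2 ω 0 1| ∈ T}
      + (1 / N) * ∑ l ∈ Finset.Ico 1 N, μ.real (D ∩ {ω | |R2 ω 0 l| ∈ T}) := by
  classical
  have := hs.prob
  obtain ⟨S, hS, rfl⟩ := hD
  have hDm : MeasurableSet (projRep N ⁻¹' S) := measurable_projRep N hS
  have key := hGG N hN (S.indicator fun _ => 1) (measurable_const.indicator hS)
    ⟨1, fun v => by by_cases h : v ∈ S <;> simp [h]⟩
    (fun x => T.indicator (fun _ => 1) |x|)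
    ((measurable_const.indicator hT).comp measurable_id.abs)
    ⟨1, fun x => by by_cases h : |x| ∈ T <;> simp [h]⟩ (fun x => by simp only [abs_neg])
  have a1 : ∀ l, ∫ ω, fRep N (S.indicator fun _ => 1) ω
      * (fun x : ℝ => T.indicator (fun _ => (1 : ℝ)) |x|) (R2 ω 0 l) ∂μ
      = μ.real (projRep N ⁻¹' S ∩ {ω | |R2 ω 0 l| ∈ T}) := by
    intro l
    rw [← integral_indicator_one (hDm.inter (measurableSet_abs2 hT 0 l))]
    congr 1
    funext ω
    show S.indicator (fun _ => (1 : ℝ)) (projRep N ω) * T.indicator (fun _ => (1 : ℝ)) |R2 ω 0 l| = _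
    by_cases h : projRep N ω ∈ S <;> by_cases h' : |R2 ω 0 l| ∈ T <;> simp [h, h']
  have a2 : ∫ ω, fRep N (S.indicator fun _ => 1) ω ∂μ = μ.real (projRep N ⁻¹' S) := by
    rw [← integral_indicator_one hDm]
    rfl
  have a3 : ∫ ω, (fun x : ℝ => T.indicator (fun _ => (1 : ℝ)) |x|) (R2 ω 0 1) ∂μ
      = μ.real {ω | |R2 ω 0 1| ∈ T} := by
    rw [← integral_indicator_one (measurableSet_abs2 hT 0 1)]
    rfl
  rw [a1, a2, a3] at key
  rw [key]
  congr 2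
  exact Finset.sum_congr rfl fun l _ => a1 l

lemma bad1 {μ : Measure OA} (hs : Setup μ) (hGG : GG1 μ) (n : ℕ) (hn : 1 ≤ n)
    {A A1 A2 : Set ℝ} (hA : MeasurableSet A) (hA1 : MeasurableSet A1) (hA2 : MeasurableSet A2)
    (l : ℕ) (hl : l < n) :
    μ.real (Hev 0 0 n n A A1 A2 ∩ {ω | |R1 ω l n| ∈ A1ᶜ})
      = (1 / n) * μ.real (Hev 0 0 n n A A1 A2) * μ.real {ω | |R1 ω 0 1| ∈ A1ᶜ} := by
  have hsw : ∀ x, Equiv.swap 0 l x < n ↔ x < n := swap_lt_iff (by omega)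
  have hid : ∀ x, (1 : Equiv.Perm ℕ) x < n ↔ x < n := fun x => Iff.rfl
  have hfin : {x | (1 : Equiv.Perm ℕ) x ≠ x}.Finite := by simp
  have h1 : μ.real (Hev 0 0 n n A A1 A2) = μ.real (Hev l 0 n n A A1 A2) := by
    rw [← real_preimage_permMap hs (Equiv.swap 0 l) 1 (swap_finite 0 l) hfin
      (measurableSet_Hev hA hA1 hA2 0 0 n n)]
    congr 1
    ext ω
    rw [Set.mem_preimage, mem_Hev_perm _ _ _ _ _ _ hsw hid]
    simp
  have h2 : μ.real (Hev 0 0 n n A A1 A2 ∩ {ω | |R1 ω l n| ∈ A1ᶜ})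
      = μ.real (Hev l 0 n n A A1 A2 ∩ {ω | |R1 ω 0 n| ∈ A1ᶜ}) := by
    rw [← real_preimage_permMap hs (Equiv.swap 0 l) 1 (swap_finite 0 l) hfin
      ((measurableSet_Hev hA hA1 hA2 0 0 n n).inter (measurableSet_abs1 hA1.compl l n))]
    congr 1
    ext ω
    rw [Set.mem_preimage, Set.mem_inter_iff, mem_Hev_perm _ _ _ _ _ _ hsw hid]
    have : R1 (permMap (Equiv.swap 0 l) 1 ω) l n = R1 ω 0 n := by
      show R1 ω (Equiv.swap 0 l l) (Equiv.swap 0 l n) = _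
      rw [Equiv.swap_apply_right, Equiv.swap_apply_of_ne_of_ne (by omega) (by omega)]
    simp [this]
  rw [h2, GG1_set hs hGG n hn hA1.compl
    (Hev_eq_preimage hA hA1 hA2 l 0 n n n hl (by omega) le_rfl le_rfl), ← h1,
    Finset.sum_eq_zero, mul_zero, add_zero]
  intro k hk
  rw [Finset.mem_Ico] at hk
  have : Hev l 0 n n A A1 A2 ∩ {ω | |R1 ω 0 k| ∈ A1ᶜ} = ∅ := by
    ext ω
    simp only [Set.mem_inter_iff, Set.mem_empty_iff_false, iff_false, not_and]
    intro h h'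
    exact h' (h.1.2 0 k (by omega) hk.2 (by omega))
  rw [this, measureReal_empty]

lemma bad2 {μ : Measure OA} (hs : Setup μ) (hGG : GG2 μ) (n : ℕ) (hn : 1 ≤ n)
    {A A1 A2 : Set ℝ} (hA : MeasurableSet A) (hA1 : MeasurableSet A1) (hA2 : MeasurableSet A2)
    (l : ℕ) (hl : l < n) :
    μ.real (Hev 0 0 (n + 1) n A A1 A2 ∩ {ω | |R2 ω l n| ∈ A2ᶜ})
      = (1 / n) * μ.real (Hev 0 0 (n + 1) n A A1 A2) * μ.real {ω | |R2 ω 0 1| ∈ A2ᶜ} := by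
  have hsw : ∀ x, Equiv.swap 0 l x < n ↔ x < n := swap_lt_iff (by omega)
  have hsw' : ∀ x, Equiv.swap n (n + 1) x < n ↔ x < n := swap_lt_iff (by omega)
  have hid : ∀ x, (1 : Equiv.Perm ℕ) x < n + 1 ↔ x < n + 1 := fun x => Iff.rfl
  have hfin : {x | (1 : Equiv.Perm ℕ) x ≠ x}.Finite := by simp
  have h1 : μ.real (Hev 0 0 (n + 1) n A A1 A2) = μ.real (Hev 0 l (n + 1) n A A1 A2) := by
    rw [← real_preimage_permMap hs 1 (Equiv.swap 0 l) hfin (swap_finite 0 l)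
      (measurableSet_Hev hA hA1 hA2 0 0 (n + 1) n)]
    congr 1
    ext ω
    rw [Set.mem_preimage, mem_Hev_perm _ _ _ _ _ _ hid hsw]
    simp
  have h2 : μ.real (Hev 0 0 (n + 1) n A A1 A2 ∩ {ω | |R2 ω l n| ∈ A2ᶜ})
      = μ.real (Hev 0 l (n + 1) n A A1 A2 ∩ {ω | |R2 ω 0 n| ∈ A2ᶜ}) := by
    rw [← real_preimage_permMap hs 1 (Equiv.swap 0 l) hfin (swap_finite 0 l)
      ((measurableSet_Hev hA hA1 hA2 0 0 (n + 1) n).inter (measurableSet_abs2 hA2.compl l n))]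
    congr 1
    ext ω
    rw [Set.mem_preimage, Set.mem_inter_iff, mem_Hev_perm _ _ _ _ _ _ hid hsw]
    have : R2 (permMap 1 (Equiv.swap 0 l) ω) l n = R2 ω 0 n := by
      show R2 ω (Equiv.swap 0 l l) (Equiv.swap 0 l n) = _
      rw [Equiv.swap_apply_right, Equiv.swap_apply_of_ne_of_ne (by omega) (by omega)]
    simp [this]
  have h3 : μ.real (Hev 0 l (n + 1) n A A1 A2 ∩ {ω | |R2 ω 0 n| ∈ A2ᶜ})
      = μ.real (Hev 0 l (n + 1) n A A1 A2 ∩ {ω | |R2 ω 0 (n + 1)| ∈ A2ᶜ}) := by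
    rw [← real_preimage_permMap hs 1 (Equiv.swap n (n + 1)) hfin (swap_finite n (n + 1))
      ((measurableSet_Hev hA hA1 hA2 0 l (n + 1) n).inter (measurableSet_abs2 hA2.compl 0 n))]
    congr 1
    ext ω
    rw [Set.mem_preimage, Set.mem_inter_iff, mem_Hev_perm _ _ _ _ _ _ hid hsw']
    have : R2 (permMap 1 (Equiv.swap n (n + 1)) ω) 0 n = R2 ω 0 (n + 1) := by
      show R2 ω (Equiv.swap n (n + 1) 0) (Equiv.swap n (n + 1) n) = _
      rw [Equiv.swap_apply_left, Equiv.swap_apply_of_ne_of_ne (by omega) (by omega)]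
    have h' : Equiv.swap n (n + 1) l = l := Equiv.swap_apply_of_ne_of_ne (by omega) (by omega)
    simp [this, h']
  have key := GG2_set hs hGG (n + 1) (by omega) hA2.compl
    (Hev_eq_preimage hA hA1 hA2 0 l (n + 1) n (n + 1) (by omega) (by omega) le_rfl (by omega))
  rw [Finset.sum_Ico_succ_top hn, Finset.sum_eq_zero, zero_add, h3, ← h1] at key
  · rw [h2, h3]
    have hn0 : (n : ℝ) ≠ 0 := by positivity
    have hn1 : (n : ℝ) + 1 ≠ 0 := by positivity
    push_cast at key
    field_simp at key ⊢
    linarith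
  · intro k hk
    rw [Finset.mem_Ico] at hk
    have : Hev 0 l (n + 1) n A A1 A2 ∩ {ω | |R2 ω 0 k| ∈ A2ᶜ} = ∅ := by
      ext ω
      simp only [Set.mem_inter_iff, Set.mem_empty_iff_false, iff_false, not_and]
      intro h h'
      exact h' (h.2 0 k (by omega) hk.2 (by omega))
    rw [this, measureReal_empty]

/-- The union bound. -/
lemma union_step {μ : Measure OA} (hs : Setup μ) (n : ℕ) (hn : 1 ≤ n) {B C P : Set OA}
    {F : ℕ → Set OA} (hP : MeasurableSet P)
    (hF : ∀ l < n, μ.real (B ∩ F l) = (1 / n) * μ.real B * μ.real Pᶜ)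
    (hsub : ∀ᵐ ω ∂μ, ω ∈ B → ω ∈ C ∨ ∃ l < n, ω ∈ F l) :
    μ.real B * μ.real P ≤ μ.real C := by
  have := hs.prob
  have hle : μ.real B ≤ μ.real (C ∪ ⋃ l ∈ Finset.range n, B ∩ F l) := by
    refine ENNReal.toReal_mono (measure_ne_top _ _) (measure_mono_ae ?_)
    filter_upwards [hsub] with ω h hB
    rcases h hB with h | ⟨l, hl, h⟩
    · exact Or.inl h
    · exact Or.inr (Set.mem_biUnion (Finset.mem_coe.2 (Finset.mem_range.2 hl)) ⟨hB, h⟩)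
  have h2 : μ.real (C ∪ ⋃ l ∈ Finset.range n, B ∩ F l)
      ≤ μ.real C + ∑ l ∈ Finset.range n, μ.real (B ∩ F l) :=
    (measureReal_union_le _ _).trans (by gcongr; exact measureReal_biUnion_finset_le _ _)
  rw [Finset.sum_congr rfl fun l hl => hF l (Finset.mem_range.1 hl), Finset.sum_const,
    Finset.card_range, nsmul_eq_mul, probReal_compl_eq_one_sub hP] at h2
  have hn0 : (n : ℝ) ≠ 0 := by positivity
  have h3 : (n : ℝ) * (1 / n * μ.real B * (1 - μ.real P)) = μ.real B * (1 - μ.real P) := by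
    field_simp
  rw [h3] at h2
  linarith

lemma step1 {μ : Measure OA} (hs : Setup μ) (hGG : GG1 μ) (n : ℕ) (hn : 1 ≤ n)
    {A A1 A2 : Set ℝ} (hA : MeasurableSet A) (hA1 : MeasurableSet A1) (hA2 : MeasurableSet A2) :
    μ.real (Hev 0 0 n n A A1 A2) * μ.real {ω | |R1 ω 0 1| ∈ A1}
      ≤ μ.real (Hev 0 0 (n + 1) n A A1 A2) := by
  refine union_step hs n hn (F := fun l => {ω | |R1 ω l n| ∈ A1ᶜ}) (measurableSet_abs1 hA1 0 1)
    (fun l hl => bad1 hs hGG n hn hA hA1 hA2 l hl) ?_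
  filter_upwards [hs.symm] with ω hsym hB
  by_contra! hcon
  have hF : ∀ l < n, |R1 ω l n| ∈ A1 := fun l hl => by simpa using hcon.2 l hl
  refine hcon.1 ⟨⟨hB.1.1, fun a b ha hb hab => ?_⟩, hB.2⟩
  by_cases ha' : a < n
  · by_cases hb' : b < n
    · exact hB.1.2 a b ha' hb' hab
    · obtain rfl : b = n := by omega
      exact hF a ha'
  · obtain rfl : a = n := by omega
    rw [(hsym a b).1]
    exact hF b (by omega)

lemma step2 {μ : Measure OA} (hs : Setup μ) (hGG : GG2 μ) (n : ℕ) (hn : 1 ≤ n)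
    {A A1 A2 : Set ℝ} (hA : MeasurableSet A) (hA1 : MeasurableSet A1) (hA2 : MeasurableSet A2) :
    μ.real (Hev 0 0 (n + 1) n A A1 A2) * μ.real {ω | |R2 ω 0 1| ∈ A2}
      ≤ μ.real (Hev 0 0 (n + 1) (n + 1) A A1 A2) := by
  refine union_step hs n hn (F := fun l => {ω | |R2 ω l n| ∈ A2ᶜ}) (measurableSet_abs2 hA2 0 1)
    (fun l hl => bad2 hs hGG n hn hA hA1 hA2 l hl) ?_
  filter_upwards [hs.symm] with ω hsym hB
  by_contra! hcon
  have hF : ∀ l < n, |R2 ω l n| ∈ A2 := fun l hl => by simpa using hcon.2 l hl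
  refine hcon.1 ⟨hB.1, fun a b ha hb hab => ?_⟩
  by_cases ha' : a < n
  · by_cases hb' : b < n
    · exact hB.2 a b ha' hb' hab
    · obtain rfl : b = n := by omega
      exact hF a ha'
  · obtain rfl : a = n := by omega
    rw [(hsym a b).2]
    exact hF b (by omega)

lemma main_real {μ : Measure OA} (hs : Setup μ) (hGG1 : GG1 μ) (hGG2 : GG2 μ) (n : ℕ)
    {A A1 A2 : Set ℝ} (hA : MeasurableSet A) (hA1 : MeasurableSet A1) (hA2 : MeasurableSet A2) :
    (μ.real {ω | |R1 ω 0 1| ∈ A1} * μ.real {ω | |R2 ω 0 1| ∈ A2}) ^ n * μ.real {ω | R ω 0 0 ∈ A}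
      ≤ μ.real (Hev 0 0 (n + 1) (n + 1) A A1 A2) := by
  induction n with
  | zero =>
    have : Hev 0 0 (0 + 1) (0 + 1) A A1 A2 = {ω | R ω 0 0 ∈ A} := by
      ext ω
      refine ⟨fun h => h.1.1, fun h => ⟨⟨h, ?_⟩, ?_⟩⟩ <;>
      · intro a b ha hb hab
        omega
    rw [this]
    simp
  | succ n ih =>
    have h1 := step1 hs hGG1 (n + 1) (by omega) hA hA1 hA2
    have h2 := step2 hs hGG2 (n + 1) (by omega) hA hA1 hA2
    refine le_trans ?_ ((mul_le_mul_of_nonneg_right h1 measureReal_nonneg).trans h2)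
    have h3 := mul_le_mul_of_nonneg_right ih
      (mul_nonneg (measureReal_nonneg (μ := μ) (s := {ω | |R1 ω 0 1| ∈ A1}))
        (measureReal_nonneg (μ := μ) (s := {ω | |R2 ω 0 1| ∈ A2})))
    rw [pow_succ]
    linarith

end OverlapArray

/-- In the overlap array setup, if `μ` satisfies the Ghirlanda–Guerra
identities for both systems, then for every `n ≥ 1` and all Borel sets `A ⊆ [-1,1]`,
`A₁, A₂ ⊆ [0,1]`, one has `μ(B_n) ≥ (μ₁(A₁) μ₂(A₂))^{n−1} · μ_{1,2}(A)`. -/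
theorem statement_12 (μ : Measure OA) (hsetup : Setup μ) (hGG1 : GG1 μ) (hGG2 : GG2 μ)
    (n : ℕ) (hn : 1 ≤ n) (A A1 A2 : Set ℝ)
    (hA : MeasurableSet A) (hA1 : MeasurableSet A1) (hA2 : MeasurableSet A2)
    (hAsub : A ⊆ Set.Icc (-1) 1) (hA1sub : A1 ⊆ Set.Icc 0 1) (hA2sub : A2 ⊆ Set.Icc 0 1) :
    μ (Bev n A A1 A2)
      ≥ (μ {ω | |R1 ω 0 1| ∈ A1} * μ {ω | |R2 ω 0 1| ∈ A2}) ^ (n - 1)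
          * μ {ω | R ω 0 0 ∈ A} := by
  have := hsetup.prob
  obtain ⟨m, rfl⟩ : ∃ m, n = m + 1 := ⟨n - 1, by omega⟩
  have key := main_real hsetup hGG1 hGG2 m hA hA1 hA2
  rw [ge_iff_le, ← ENNReal.toReal_le_toReal (by finiteness) (by finiteness)]
  simpa [measureReal_def, Hev, Bev, EA] using key
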